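/- Let G be a d-regular graph on n vertices with d > 0 whose second largest absolute adjacency eigenvalue is at most λ. If A and B are disjoint subsets of V(G) with A nonempty, A ∪ B = V(G) is NOT required, and there are no edges of G between A and B, then d²·|A|·|B|/(λ²·n) < n − |B| whenever λ > 0 and B is nonempty. -/

import Mathlib

open Finset

/-- The adjacency matrix of a simple graph over `ℝ` is Hermitian. -/
theorem adjMatrix_isHermitian {V : Type*} [Fintype V] (G : SimpleGraph V)
    [DecidableRel G.Adj] : (G.adjMatrix ℝ).IsHermitian := by
  unfold Matrix.IsHermitian
  rw [Matrix.conjTranspose_eq_transpose_of_trivial]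
  exact G.isSymm_adjMatrix

/-- The second largest absolute eigenvalue of the adjacency matrix of `G`:
if the eigenvalues are `λ₁ ≥ λ₂ ≥ ... ≥ λₙ`, this is `max_{2 ≤ i ≤ n} |λᵢ|`
(interpreted as `0` when `n ≤ 1`). -/
noncomputable def sndAbsEig {V : Type*} [Fintype V] [DecidableEq V] (G : SimpleGraph V)
    [DecidableRel G.Adj] : ℝ :=
  (((((Multiset.map (adjMatrix_isHermitian G).eigenvalues Finset.univ.val).sort (· ≤ ·)).dropLast).map
    (fun x => |x|)).foldr max 0)

/-- `eAB G A B` is the number of edges of `G` with one end in `A` and the other end in `B`,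
where edges with both ends in `A ∩ B` are counted twice. -/
def eAB {V : Type*} (G : SimpleGraph V) [DecidableRel G.Adj] (A B : Finset V) : ℕ :=
  ∑ a ∈ A, ∑ b ∈ B, if G.Adj a b then 1 else 0

/-- `eIn G A` is the number of edges of `G` with both ends in `A`. -/
noncomputable def eIn {V : Type*} [Fintype V] [DecidableEq V] (G : SimpleGraph V)
    [DecidableRel G.Adj] (A : Finset V) : ℕ :=
  letI := Classical.dec
  (G.edgeFinset.filter (fun e => ∀ v ∈ e, v ∈ A)).card

/-- The number of connected components of the graph obtained from `G`
by deleting the vertices of `S`. -/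
noncomputable def numComp {V : Type*} [Fintype V] [DecidableEq V] (G : SimpleGraph V)
    (S : Finset V) : ℕ :=
  Nat.card (G.induce ((Sᶜ : Finset V) : Set V)).ConnectedComponent

/-- Dropping the last entry of an ascending sort removes a maximal element. -/
theorem Multiset.dropLast_sort_cons {α : Type*} [LinearOrder α] (a : α) (s : Multiset α)
    (h : ∀ x ∈ s, x ≤ a) : ((a ::ₘ s).sort (· ≤ ·)).dropLast = s.sort (· ≤ ·) := by
  have key : (a ::ₘ s).sort (· ≤ ·) = s.sort (· ≤ ·) ++ [a] := by
    refine List.Perm.eq_of_pairwise' (r := (· ≤ ·)) (Multiset.pairwise_sort _ _) ?_ ?_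
    · rw [List.pairwise_append]
      refine ⟨Multiset.pairwise_sort _ _, List.pairwise_singleton _ _, fun x hx y hy => ?_⟩
      rw [List.mem_singleton.1 hy]
      exact h x ((Multiset.mem_sort _).1 hx)
    · rw [← Multiset.coe_eq_coe, Multiset.sort_eq, ← Multiset.coe_add, Multiset.sort_eq,
        Multiset.coe_singleton, add_comm, Multiset.singleton_add]
  rw [key, List.dropLast_concat]

theorem List.le_foldr_max {α : Type*} [LinearOrder α] (b : α) {l : List α} {x : α}
    (h : x ∈ l) : x ≤ l.foldr max b := by
  induction l with
  | nil => simp at h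
  | cons a l ih =>
    rcases List.mem_cons.1 h with rfl | h
    · exact le_max_left _ _
    · exact (ih h).trans (le_max_right _ _)

section

variable {V : Type*} [Fintype V]

open Matrix in
theorem SimpleGraph.IsRegularOfDegree.dotProduct_adjMatrix_mulVec_self_le {G : SimpleGraph V}
    [DecidableRel G.Adj] {d : ℕ} (hreg : G.IsRegularOfDegree d) (y : V → ℝ) :
    (G.adjMatrix ℝ *ᵥ y) ⬝ᵥ (G.adjMatrix ℝ *ᵥ y) ≤ (d : ℝ) ^ 2 * (y ⬝ᵥ y) := by
  have hdeg : ∀ w, ∑ v, (if G.Adj v w then (1 : ℝ) else 0) = d := fun w => by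
    simp only [G.adj_comm _ w]
    rw [Finset.sum_boole, ← hreg w, ← G.card_neighborFinset_eq_degree, G.neighborFinset_eq_filter]
  calc (G.adjMatrix ℝ *ᵥ y) ⬝ᵥ (G.adjMatrix ℝ *ᵥ y)
      = ∑ v, (∑ w ∈ G.neighborFinset v, y w) ^ 2 := by
        simp only [dotProduct, SimpleGraph.adjMatrix_mulVec_apply, sq]
    _ ≤ ∑ v, (d : ℝ) * ∑ w ∈ G.neighborFinset v, y w ^ 2 := by
        refine Finset.sum_le_sum fun v _ => ?_
        have h := sq_sum_le_card_mul_sum_sq (s := G.neighborFinset v) (f := y)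
        rwa [G.card_neighborFinset_eq_degree, hreg v] at h
    _ = (d : ℝ) * ∑ w, (∑ v, if G.Adj v w then (1 : ℝ) else 0) * y w ^ 2 := by
        rw [← Finset.mul_sum]
        congr 1
        simp only [G.neighborFinset_eq_filter, Finset.sum_filter, Finset.sum_mul]
        rw [Finset.sum_comm]
        simp
    _ = (d : ℝ) ^ 2 * (y ⬝ᵥ y) := by
        simp only [hdeg, dotProduct, ← Finset.mul_sum, sq]
        ring

variable [DecidableEq V]

theorem exists_forall_ne_abs_eigenvalues_le_sndAbsEig [Nonempty V] (G : SimpleGraph V)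
    [DecidableRel G.Adj] :
    ∃ i₀, ∀ i, i ≠ i₀ → |(adjMatrix_isHermitian G).eigenvalues i| ≤ sndAbsEig G := by
  obtain ⟨i₀, hi₀⟩ := Finite.exists_max (adjMatrix_isHermitian G).eigenvalues
  refine ⟨i₀, fun i hi => ?_⟩
  have hsplit : Multiset.map (adjMatrix_isHermitian G).eigenvalues Finset.univ.val =
      (adjMatrix_isHermitian G).eigenvalues i₀ ::ₘ
        Multiset.map (adjMatrix_isHermitian G).eigenvalues (Finset.univ.erase i₀).val := by
    rw [← Multiset.map_cons, Finset.erase_val, Multiset.cons_erase (Finset.mem_univ_val i₀)]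
  unfold sndAbsEig
  rw [hsplit, Multiset.dropLast_sort_cons]
  · refine List.le_foldr_max _ (List.mem_map.2 ⟨_, (Multiset.mem_sort _).2 ?_, rfl⟩)
    exact Multiset.mem_map_of_mem _ (Finset.mem_erase.2 ⟨hi, Finset.mem_univ i⟩)
  · intro x hx
    obtain ⟨j, -, rfl⟩ := Multiset.mem_map.1 hx
    exact hi₀ j

open Matrix in
theorem Matrix.IsHermitian.sum_dotProduct_eigenvectorBasis_mul {M : Matrix V V ℝ}
    (hM : M.IsHermitian) (x y : V → ℝ) :
    ∑ i, (⇑(hM.eigenvectorBasis i) ⬝ᵥ x) * (⇑(hM.eigenvectorBasis i) ⬝ᵥ y) = x ⬝ᵥ y := by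
  have h := hM.eigenvectorBasis.sum_inner_mul_inner (WithLp.toLp 2 x) (WithLp.toLp 2 y)
  simp only [EuclideanSpace.inner_eq_star_dotProduct, star_trivial] at h
  rw [dotProduct_comm x y, ← h]
  exact Finset.sum_congr rfl fun i _ => by rw [dotProduct_comm _ y]

open Matrix in
theorem Matrix.IsHermitian.dotProduct_eigenvectorBasis_mulVec {M : Matrix V V ℝ}
    (hM : M.IsHermitian) (i : V) (x : V → ℝ) :
    ⇑(hM.eigenvectorBasis i) ⬝ᵥ (M *ᵥ x) =
      hM.eigenvalues i * (⇑(hM.eigenvectorBasis i) ⬝ᵥ x) := by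
  have hT : Mᵀ = M := by rw [← conjTranspose_eq_transpose_of_trivial]; exact hM
  rw [dotProduct_mulVec, ← mulVec_transpose, hT, hM.mulVec_eigenvectorBasis, smul_dotProduct,
    smul_eq_mul]

open Matrix in
/-- On vectors orthogonal to the constants, the adjacency matrix of a regular graph has norm at
most the second largest absolute eigenvalue. -/
theorem SimpleGraph.IsRegularOfDegree.dotProduct_adjMatrix_mulVec_self_le_of_sum_eq_zero
    [Nonempty V] {G : SimpleGraph V} [DecidableRel G.Adj] {d : ℕ} (hreg : G.IsRegularOfDegree d)
    {lam : ℝ} (hlam : sndAbsEig G ≤ lam) (y : V → ℝ) (hy : ∑ v, y v = 0) :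
    (G.adjMatrix ℝ *ᵥ y) ⬝ᵥ (G.adjMatrix ℝ *ᵥ y) ≤ lam ^ 2 * (y ⬝ᵥ y) := by
  rcases le_or_gt (d : ℝ) lam with hd | hd
  · refine (hreg.dotProduct_adjMatrix_mulVec_self_le y).trans ?_
    refine mul_le_mul_of_nonneg_right (by gcongr) ?_
    exact Finset.sum_nonneg fun v _ => mul_self_nonneg (y v)
  obtain ⟨i₀, hi₀⟩ := exists_forall_ne_abs_eigenvalues_le_sndAbsEig G
  set hM := adjMatrix_isHermitian G
  have hone : G.adjMatrix ℝ *ᵥ (1 : V → ℝ) = (d : ℝ) • (1 : V → ℝ) := by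
    ext v
    simp [SimpleGraph.adjMatrix_mulVec_apply, hreg v]
  have horth : ∀ i, i ≠ i₀ → ⇑(hM.eigenvectorBasis i) ⬝ᵥ (1 : V → ℝ) = 0 := by
    intro i hi
    have h := hM.dotProduct_eigenvectorBasis_mulVec i 1
    rw [hone, dotProduct_smul, smul_eq_mul] at h
    have hlt : hM.eigenvalues i < d := ((le_abs_self _).trans ((hi₀ i hi).trans hlam)).trans_lt hd
    by_contra h0
    exact hlt.ne' (mul_right_cancel₀ h0 h)
  have hsingle : ∀ x : V → ℝ, (⇑(hM.eigenvectorBasis i₀) ⬝ᵥ (1 : V → ℝ)) *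
      (⇑(hM.eigenvectorBasis i₀) ⬝ᵥ x) = 1 ⬝ᵥ x := fun x => by
    rw [← hM.sum_dotProduct_eigenvectorBasis_mul 1 x, Finset.sum_eq_single i₀]
    · exact fun i _ hi => by rw [horth i hi, zero_mul]
    · simp
  have hne : ⇑(hM.eigenvectorBasis i₀) ⬝ᵥ (1 : V → ℝ) ≠ 0 := fun h0 => by
    have h := hsingle 1
    rw [h0] at h
    simp [eq_comm] at h
  have hy0 : ⇑(hM.eigenvectorBasis i₀) ⬝ᵥ y = 0 := by
    have h := hsingle y
    rw [one_dotProduct, hy] at h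
    exact (mul_eq_zero.1 h).resolve_left hne
  rw [← hM.sum_dotProduct_eigenvectorBasis_mul, ← hM.sum_dotProduct_eigenvectorBasis_mul y y,
    Finset.mul_sum]
  refine Finset.sum_le_sum fun i _ => ?_
  rw [hM.dotProduct_eigenvectorBasis_mulVec]
  rcases eq_or_ne i i₀ with rfl | hi
  · simp [hy0]
  · have h := pow_le_pow_left₀ (abs_nonneg _) ((hi₀ i hi).trans hlam) 2
    rw [sq_abs] at h
    linarith [mul_le_mul_of_nonneg_right h (mul_self_nonneg (⇑(hM.eigenvectorBasis i) ⬝ᵥ y))]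

end

theorem no_edges_strict_bound
    {V : Type*} [Fintype V] [DecidableEq V] (G : SimpleGraph V) [DecidableRel G.Adj]
    (n d : ℕ) (lam : ℝ) (hn : Fintype.card V = n) (hd : 0 < d)
    (hreg : G.IsRegularOfDegree d) (hlam : sndAbsEig G ≤ lam) (hlampos : 0 < lam)
    (A B : Finset V) (hA : A.Nonempty) (hB : B.Nonempty) (hAB : Disjoint A B)
    (hnoedge : ∀ a ∈ A, ∀ b ∈ B, ¬ G.Adj a b) :
    (d : ℝ) ^ 2 * (A.card : ℝ) * (B.card : ℝ) / (lam ^ 2 * (n : ℝ)) <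
      (n : ℝ) - (B.card : ℝ) := by
  obtain ⟨a₀, ha₀⟩ := hA
  have : Nonempty V := ⟨a₀⟩
  have hn0 : (0 : ℝ) < n := by rw [← hn]; exact_mod_cast Fintype.card_pos
  have hb : (0 : ℝ) < B.card := by exact_mod_cast hB.card_pos
  have ha : (0 : ℝ) < A.card := by exact_mod_cast Finset.card_pos.2 ⟨a₀, ha₀⟩
  have hd0 : (0 : ℝ) < d := by exact_mod_cast hd
  let y : V → ℝ := fun v => (if v ∈ B then 1 else 0) - B.card / n
  let z : V → ℝ := (G.adjMatrix ℝ).mulVec y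
  have hysum : ∑ v, y v = 0 := by
    simp only [y, Finset.sum_sub_distrib, Finset.sum_const, Finset.card_univ, hn, nsmul_eq_mul,
      Finset.sum_boole, Finset.filter_univ_mem]
    field_simp
    ring
  have hysq : y ⬝ᵥ y = B.card * (n - B.card) / n := by
    have hpt : ∀ v, y v * y v =
        (1 - 2 * (B.card / n : ℝ)) * (if v ∈ B then 1 else 0) + (B.card / n : ℝ) ^ 2 := by
      intro v
      simp only [y]
      split_ifs <;> ring
    simp only [dotProduct, hpt, Finset.sum_add_distrib, ← Finset.mul_sum, Finset.sum_const,
      Finset.card_univ, hn, nsmul_eq_mul, Finset.sum_boole, Finset.filter_univ_mem]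
    field_simp
    ring
  have hzsum : ∑ v, z v = 0 := by
    have h : (1 : V → ℝ) ⬝ᵥ z = (d : ℝ) * ∑ v, y v := by
      simp only [z]
      rw [Matrix.dotProduct_mulVec]
      simp only [dotProduct, SimpleGraph.adjMatrix_vecMul_apply, Pi.one_apply, Finset.sum_const,
        G.card_neighborFinset_eq_degree, hreg _, nsmul_eq_mul, mul_one, Finset.mul_sum]
    rw [one_dotProduct, hysum, mul_zero] at h
    exact h
  have hzA : ∀ v ∈ A, z v = -(d * B.card / n) := by
    intro v hv
    simp only [z, y, SimpleGraph.adjMatrix_mulVec_apply, Finset.sum_sub_distrib, Finset.sum_const,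
      G.card_neighborFinset_eq_degree, hreg _, nsmul_eq_mul]
    rw [Finset.sum_eq_zero]
    · ring
    · intro w hw
      rw [if_neg fun hwB => hnoedge v hv w hwB ((G.mem_neighborFinset v w).1 hw)]
  have hzne : ∃ v ∈ Aᶜ, z v ≠ 0 := by
    by_contra! h
    rw [← Finset.sum_add_sum_compl A, Finset.sum_congr rfl hzA, Finset.sum_eq_zero h,
      Finset.sum_const, nsmul_eq_mul] at hzsum
    have : (0 : ℝ) < A.card * (d * B.card / n) := by positivity
    linarith
  have hzlow : A.card * (d * B.card / n : ℝ) ^ 2 < z ⬝ᵥ z := by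
    have hcompl : 0 < ∑ v ∈ Aᶜ, z v * z v := by
      obtain ⟨v, hv, hv0⟩ := hzne
      exact Finset.sum_pos' (fun w _ => mul_self_nonneg _) ⟨v, hv, mul_self_pos.2 hv0⟩
    have hAsum : ∑ v ∈ A, z v * z v = A.card * (d * B.card / n : ℝ) ^ 2 := by
      rw [Finset.sum_congr rfl fun v hv => by rw [hzA v hv], Finset.sum_const, nsmul_eq_mul]
      ring
    rw [dotProduct, ← Finset.sum_add_sum_compl A, hAsum]
    linarith
  have hlt := hzlow.trans_le
    (hreg.dotProduct_adjMatrix_mulVec_self_le_of_sum_eq_zero hlam y hysum)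
  rw [hysq] at hlt
  rw [div_lt_iff₀ (by positivity)]
  have hl : (A.card : ℝ) * (d * B.card / n) ^ 2 =
      (B.card / n ^ 2 : ℝ) * (d ^ 2 * A.card * B.card) := by ring
  have hr : lam ^ 2 * (B.card * (n - B.card) / n) =
      (B.card / n ^ 2 : ℝ) * ((n - B.card) * (lam ^ 2 * n)) := by field_simp
  rw [hl, hr] at hlt
  exact lt_of_mul_lt_mul_left hlt (by positivity)
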